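/- Let G be a simple graph and let C₁ and C₂ be two cycles of G such that V(C₁) ∩ V(C₂) = {v} for a single vertex v. If there exist an edge (u, v) of C₁ and an edge (w, v) of C₂ such that u is adjacent to w, then G contains a cycle whose vertex set is exactly V(C₁) ∪ V(C₂). (Proposition 4 of the paper.) -/

import Mathlib

lemma cycle_open_path {V : Type*} (G : SimpleGraph V) {a : V} (c : G.Walk a a) (hc : c.IsCycle)
    (u v : V) (h : s(u, v) ∈ c.edges) :
    ∃ p : G.Walk u v, p.IsPath ∧ ∀ z, z ∈ p.support ↔ z ∈ c.support := by
  classical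
  have hv : v ∈ c.support := c.snd_mem_support_of_mem_edges h
  have hr : (c.rotate v hv).IsCycle := hc.rotate hv
  have hadj : (c.rotate v hv).toSubgraph.Adj v u := by
    rw [SimpleGraph.Walk.toSubgraph_rotate, SimpleGraph.Walk.adj_toSubgraph_iff_mem_edges,
      Sym2.eq_swap]
    exact h
  obtain ⟨p, hp, hsnd, hverts⟩ := hr.exists_isCycle_snd_verts_eq hadj
  subst hsnd
  refine ⟨p.tail, hp.isPath_tail, fun z => ?_⟩
  have hz : z ∈ p.support ↔ z ∈ c.support := by
    rw [← SimpleGraph.Walk.mem_verts_toSubgraph, hverts, SimpleGraph.Walk.mem_verts_toSubgraph,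
      SimpleGraph.Walk.mem_support_rotate_iff]
  rw [← hz, ← SimpleGraph.Walk.cons_support_tail hp.not_nil, List.mem_cons]
  constructor
  · exact Or.inr
  · rintro (rfl | h)
    · exact p.tail.end_mem_support
    · exact h

/-- Proposition 4: two cycles `C₁`, `C₂` sharing exactly one vertex `v`, with edges
`(u, v) ∈ C₁` and `(w, v) ∈ C₂` such that `u ~ w`, can be concatenated into a cycle
on vertex set `V(C₁) ∪ V(C₂)`. -/
theorem cycle_cycle_vertex_merge {V : Type*} [Fintype V] (G : SimpleGraph V)
    {a : V} (c₁ : G.Walk a a) (hc₁ : c₁.IsCycle)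
    {b : V} (c₂ : G.Walk b b) (hc₂ : c₂.IsCycle)
    (v : V) (hv : {w | w ∈ c₁.support} ∩ {w | w ∈ c₂.support} = {v})
    (u w : V)
    (h₁ : s(u, v) ∈ c₁.edges) (h₂ : s(w, v) ∈ c₂.edges)
    (huw : G.Adj u w) :
    ∃ (d : V) (c' : G.Walk d d), c'.IsCycle ∧
      {z | z ∈ c'.support} = {z | z ∈ c₁.support} ∪ {z | z ∈ c₂.support} := by
  obtain ⟨p, hp, hps⟩ := cycle_open_path G c₁ hc₁ u v h₁
  obtain ⟨q, hq, hqs⟩ := cycle_open_path G c₂ hc₂ w v h₂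
  have hcap : ∀ z, z ∈ p.support → z ∈ q.support → z = v := fun z h h' => by
    have : z ∈ ({v} : Set V) := hv ▸ ⟨(hps z).1 h, (hqs z).1 h'⟩
    exact this
  have huv : u ≠ v := (c₁.adj_of_mem_edges h₁).ne
  have hwv : w ≠ v := (c₂.adj_of_mem_edges h₂).ne
  refine ⟨w, SimpleGraph.Walk.cons huw.symm (p.append q.reverse), ?_, ?_⟩
  · rw [SimpleGraph.Walk.cons_isCycle_iff]
    constructor
    · rw [SimpleGraph.Walk.isPath_def, SimpleGraph.Walk.support_append, List.nodup_append']
      have hq' := hq.reverse.support_nodup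
      refine ⟨hp.support_nodup, hq'.tail, fun z h h' => ?_⟩
      have hz := hcap z h (by simpa using List.mem_of_mem_tail h')
      subst hz
      rw [SimpleGraph.Walk.support_eq_cons] at hq'
      exact (List.nodup_cons.1 hq').1 h'
    · rw [SimpleGraph.Walk.edges_append, SimpleGraph.Walk.edges_reverse, List.mem_append,
        List.mem_reverse]
      rintro (h | h)
      · exact hwv (hcap w (p.fst_mem_support_of_mem_edges h) q.start_mem_support)
      · exact huv (hcap u p.start_mem_support (q.snd_mem_support_of_mem_edges h))
  · ext z
    simp only [Set.mem_setOf_eq, Set.mem_union, SimpleGraph.Walk.support_cons, List.mem_cons,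
      SimpleGraph.Walk.mem_support_append_iff, SimpleGraph.Walk.support_reverse, List.mem_reverse,
      hps, hqs]
    constructor
    · rintro (rfl | h)
      · exact Or.inr ((hqs _).1 q.start_mem_support)
      · exact h
    · exact Or.inr
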